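/- Let a, b be integers with b ∈ {0, 1} and 0 ≤ b ≤ a − 3, and let β be the unique real root greater than 1 of the polynomial P(X) = X^3 − aX^2 + bX + 1. Then L_⊗(β) ≥ 4; more precisely, there exist x, y ∈ ℤ_β with x·y ∈ fin(β) but β^3·(x·y) ∉ ℤ_β. -/

import Mathlib

open Polynomial

/-- The β-transformation `T_β(x) = βx - ⌊βx⌋`. -/
noncomputable def betaT (β : ℝ) : ℝ → ℝ := fun x => β * x - ⌊β * x⌋

/-- `fin(β)`: reals `x` such that `|x|/β^N ∈ [0,1)` and the greedy expansion of
`|x|/β^N` is finite, for some `N, n ∈ ℕ`. -/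
def finBeta (β : ℝ) : Set ℝ :=
  {x | ∃ N n : ℕ, |x| / β ^ N ∈ Set.Ico (0 : ℝ) 1 ∧ (betaT β)^[n] (|x| / β ^ N) = 0}

/-- `ℤ_β`: the set of β-integers. -/
def betaInt (β : ℝ) : Set ℝ :=
  {x | ∃ N : ℕ, |x| / β ^ N ∈ Set.Ico (0 : ℝ) 1 ∧ (betaT β)^[N] (|x| / β ^ N) = 0}

/-- `L_⊕(β)`: the least `L ∈ ℕ` such that `β^L·(x+y) ∈ ℤ_β` for all
`x, y ∈ ℤ_β` with `x + y ∈ fin(β)`. -/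
noncomputable def Lplus (β : ℝ) : ℕ :=
  sInf {L : ℕ | ∀ x ∈ betaInt β, ∀ y ∈ betaInt β,
    x + y ∈ finBeta β → β ^ L * (x + y) ∈ betaInt β}

/-- `L_⊗(β)`: the least `L ∈ ℕ` such that `β^L·(x·y) ∈ ℤ_β` for all
`x, y ∈ ℤ_β` with `x·y ∈ fin(β)`. -/
noncomputable def Lmul (β : ℝ) : ℕ :=
  sInf {L : ℕ | ∀ x ∈ betaInt β, ∀ y ∈ betaInt β,
    x * y ∈ finBeta β → β ^ L * (x * y) ∈ betaInt β}

lemma betaT_mem (β x : ℝ) : betaT β x ∈ Set.Ico (0 : ℝ) 1 :=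
  ⟨Int.fract_nonneg _, Int.fract_lt_one _⟩

lemma betaT_zero (β : ℝ) : betaT β 0 = 0 := by simp [betaT]

lemma betaT_eq {β u v : ℝ} (d : ℤ) (h : β * u = d + v) (hv0 : 0 ≤ v) (hv1 : v < 1) :
    betaT β u = v := by
  have hd : ⌊β * u⌋ = d := Int.floor_eq_iff.2 ⟨by linarith, by linarith⟩
  simp only [betaT, hd]
  linarith

lemma betaT_iterate_mem {β u : ℝ} (hu : u ∈ Set.Ico (0 : ℝ) 1) (n : ℕ) :
    (betaT β)^[n] u ∈ Set.Ico (0 : ℝ) 1 := by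
  cases n with
  | zero => exact hu
  | succ n =>
    rw [Function.iterate_succ_apply']
    exact betaT_mem _ _

lemma betaT_iterate_eq_zero_of_le {β u : ℝ} {m n : ℕ} (hmn : m ≤ n)
    (h : (betaT β)^[m] u = 0) : (betaT β)^[n] u = 0 := by
  obtain ⟨k, rfl⟩ := Nat.exists_eq_add_of_le' hmn
  rw [Function.iterate_add_apply, h]
  exact Function.iterate_fixed (betaT_zero β) k

lemma betaT_iterate_div_pow {β : ℝ} (hβ : 1 < β) {w : ℝ} (hw : w ∈ Set.Ico (0 : ℝ) 1) (k : ℕ) :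
    (betaT β)^[k] (w / β ^ k) = w := by
  induction k with
  | zero => simp
  | succ k ih =>
    have hpos : 0 < β := by linarith
    have hpow : 1 ≤ β ^ k := one_le_pow₀ hβ.le
    have hstep : betaT β (w / β ^ (k + 1)) = w / β ^ k := by
      refine betaT_eq 0 ?_ (div_nonneg hw.1 (by positivity)) ?_
      · push_cast
        field_simp
        ring
      · rw [div_lt_one (by positivity)]
        linarith [hw.2]
    rw [Function.iterate_succ_apply, hstep, ih]

/-- The tail of the expansion of `w` after the radix point does not depend on the power of `β`
used to scale `w` into `[0,1)`. -/
lemma betaT_iterate_scale {β : ℝ} (hβ : 1 < β) {w : ℝ} {M N : ℕ}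
    (hM : w / β ^ M ∈ Set.Ico (0 : ℝ) 1) (hN : w / β ^ N ∈ Set.Ico (0 : ℝ) 1) (j : ℕ) :
    (betaT β)^[j + M] (w / β ^ M) = (betaT β)^[j + N] (w / β ^ N) := by
  wlog hMN : M ≤ N generalizing M N
  · exact (this hN hM (le_of_not_ge hMN)).symm
  obtain ⟨k, rfl⟩ := Nat.exists_eq_add_of_le hMN
  rw [← add_assoc, Function.iterate_add_apply (betaT β) (j + M) k, pow_add, ← div_div,
    betaT_iterate_div_pow hβ hM]

lemma pow_mul_mem_betaInt_iff {β : ℝ} (hβ : 1 < β) {w : ℝ} {N : ℕ}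
    (hN : |w| / β ^ N ∈ Set.Ico (0 : ℝ) 1) (L : ℕ) :
    β ^ L * w ∈ betaInt β ↔ (betaT β)^[L + N] (|w| / β ^ N) = 0 := by
  have hpos : 0 < β := by linarith
  have hdiv : ∀ M : ℕ, |β ^ L * w| / β ^ (L + M) = |w| / β ^ M := fun M => by
    rw [abs_mul, abs_of_pos (pow_pos hpos L), pow_add]
    field_simp
  have hscaled : |β ^ L * w| / β ^ (L + N) ∈ Set.Ico (0 : ℝ) 1 := by rwa [hdiv]
  constructor
  · rintro ⟨M, hM, h⟩
    have := betaT_iterate_scale hβ hM hscaled 0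
    rwa [zero_add, zero_add, h, hdiv, eq_comm] at this
  · intro h
    exact ⟨L + N, hscaled, by rwa [hdiv]⟩

lemma pow_mul_mem_betaInt_mono {β : ℝ} (hβ : 1 < β) {w : ℝ} {L M : ℕ} (hLM : L ≤ M)
    (h : β ^ L * w ∈ betaInt β) : β ^ M * w ∈ betaInt β := by
  obtain ⟨N, hN⟩ := pow_unbounded_of_one_lt |w| hβ
  have hmem : |w| / β ^ N ∈ Set.Ico (0 : ℝ) 1 :=
    ⟨by positivity, (div_lt_one (by positivity)).2 hN⟩
  rw [pow_mul_mem_betaInt_iff hβ hmem] at h ⊢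
  exact betaT_iterate_eq_zero_of_le (by omega) h

/-- The integer part of a `β`-expansion is a polynomial in `β` whose values at the points of
`(-1, 1)` are bounded independently of the length of the expansion. -/
lemma exists_digit_polynomial {β A : ℝ} (hβ : 1 < β) (hA : β < A) {u : ℝ}
    (hu : u ∈ Set.Ico (0 : ℝ) 1) (n : ℕ) :
    ∃ p : ℤ[X], aeval β p = β ^ n * u - (betaT β)^[n] u ∧
      ∀ γ : ℝ, |γ| < 1 → |aeval γ p| ≤ A / (1 - |γ|) := by
  induction n with
  | zero =>
    refine ⟨0, by simp, fun γ hγ => ?_⟩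
    rw [map_zero, abs_zero]
    exact div_nonneg (by linarith) (by linarith)
  | succ n ih =>
    obtain ⟨p, hp, hb⟩ := ih
    have hv := betaT_iterate_mem (β := β) hu n
    set v := (betaT β)^[n] u with hvdef
    refine ⟨X * p + C ⌊β * v⌋, ?_, fun γ hγ => ?_⟩
    · rw [Function.iterate_succ_apply', ← hvdef]
      simp only [map_add, map_mul, aeval_X, map_intCast, hp, betaT, eq_intCast]
      ring
    · have hd0 : (0 : ℝ) ≤ (⌊β * v⌋ : ℤ) := by
        exact_mod_cast Int.floor_nonneg.2 (mul_nonneg (by linarith) hv.1)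
      have hd1 : ((⌊β * v⌋ : ℤ) : ℝ) ≤ A := by
        have := Int.floor_le (β * v)
        nlinarith [hv.2]
      have h1 : 0 < 1 - |γ| := by linarith
      simp only [map_add, map_mul, aeval_X, map_intCast, eq_intCast]
      calc |γ * aeval γ p + ((⌊β * v⌋ : ℤ) : ℝ)|
          ≤ |γ| * |aeval γ p| + ((⌊β * v⌋ : ℤ) : ℝ) := by
            refine (abs_add_le _ _).trans ?_
            rw [abs_mul, abs_of_nonneg hd0]
        _ ≤ |γ| * (A / (1 - |γ|)) + A := by
            gcongr
            exact hb γ hγ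
        _ = A / (1 - |γ|) := by
            field_simp
            ring

lemma abs_divided_difference_le {x y f g C : ℝ} (hf : |f| ≤ C) (hg : |g| ≤ C) :
    |(f - g) / (x - y)| ≤ 2 * C / |x - y| := by
  rw [abs_div]
  gcongr
  exact (abs_sub f g).trans (by linarith)

/-- Quadratic polynomials bounded at three distinct points have bounded coefficients. -/
lemma exists_coeff_bound {x y z : ℝ} (hxy : x ≠ y) (hxz : x ≠ z) (hyz : y ≠ z) (C : ℝ) :
    ∃ B : ℝ, ∀ c₀ c₁ c₂ : ℝ, |c₀ + c₁ * x + c₂ * x ^ 2| ≤ C → |c₀ + c₁ * y + c₂ * y ^ 2| ≤ C →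
      |c₀ + c₁ * z + c₂ * z ^ 2| ≤ C → |c₀| ≤ B ∧ |c₁| ≤ B ∧ |c₂| ≤ B := by
  have hxy' := sub_ne_zero.2 hxy
  have hxz' := sub_ne_zero.2 hxz
  have hyz' := sub_ne_zero.2 hyz
  set D := max (2 * C / |x - y|) (2 * C / |x - z|) with hD
  set B₂ := 2 * D / |y - z| with hB₂
  set B₁ := D + B₂ * |x + y| with hB₁
  set B₀ := C + B₁ * |x| + B₂ * |x ^ 2| with hB₀
  refine ⟨max B₀ (max B₁ B₂), fun c₀ c₁ c₂ hx hy hz => ?_⟩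
  have e1 := (abs_divided_difference_le (x := x) (y := y) hx hy).trans (le_max_left _ _ : _ ≤ D)
  have e2 := (abs_divided_difference_le (x := x) (y := z) hx hz).trans (le_max_right _ _ : _ ≤ D)
  have e3 := abs_divided_difference_le (x := y) (y := z) e1 e2
  have h2 : |c₂| ≤ B₂ := by
    convert e3 using 2
    field_simp
    ring
  have h1 : |c₁| ≤ B₁ := by
    have : c₁ = (c₀ + c₁ * x + c₂ * x ^ 2 - (c₀ + c₁ * y + c₂ * y ^ 2)) / (x - y)
        - c₂ * (x + y) := by
      field_simp
      ring
    rw [this]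
    refine (abs_sub _ _).trans (add_le_add e1 ?_)
    rw [abs_mul]
    gcongr
  have h0 : |c₀| ≤ B₀ := by
    have : c₀ = (c₀ + c₁ * x + c₂ * x ^ 2) - c₁ * x - c₂ * x ^ 2 := by ring
    rw [this]
    refine (abs_sub _ _).trans (add_le_add ((abs_sub _ _).trans (add_le_add hx ?_)) ?_)
    all_goals
      rw [abs_mul]
      gcongr
  exact ⟨h0.trans (le_max_left _ _), h1.trans ((le_max_left _ _).trans (le_max_right _ _)),
    h2.trans ((le_max_right _ _).trans (le_max_right _ _))⟩

lemma Int.finite_abs_le (B : ℝ) : {n : ℤ | |(n : ℝ)| ≤ B}.Finite := by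
  refine (Set.finite_Icc (-⌈B⌉) ⌈B⌉).subset fun n hn => ?_
  have h := abs_le.1 (le_trans hn (Int.le_ceil B))
  exact ⟨by exact_mod_cast h.1, by exact_mod_cast h.2⟩

/-- There are finitely many elements of `ℤ[x]` whose conjugates are all bounded by `C`, for a root
`x` of a monic integer cubic with distinct real roots. -/
lemma finite_aeval_of_bounded {P : ℤ[X]} (hP : P.Monic) (hdeg : P.natDegree = 3) {x y z : ℝ}
    (hxy : x ≠ y) (hxz : x ≠ z) (hyz : y ≠ z) (hx : aeval x P = 0) (hy : aeval y P = 0)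
    (hz : aeval z P = 0) (C : ℝ) :
    {t : ℝ | ∃ p : ℤ[X], aeval x p = t ∧ |aeval x p| ≤ C ∧ |aeval y p| ≤ C ∧
      |aeval z p| ≤ C}.Finite := by
  obtain ⟨B, hB⟩ := exists_coeff_bound hxy hxz hyz C
  have hfin := Int.finite_abs_le B
  refine ((hfin.prod (hfin.prod hfin)).image
    fun c : ℤ × ℤ × ℤ => (c.1 : ℝ) + c.2.1 * x + c.2.2 * x ^ 2).subset ?_
  rintro t ⟨p, rfl, h1, h2, h3⟩
  have hlt : (p %ₘ P).natDegree < 3 := by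
    rw [← hdeg]
    exact natDegree_modByMonic_lt p hP (by rintro rfl; simp at hdeg)
  have hev : ∀ w : ℝ, aeval w P = 0 → aeval w p =
      ((p %ₘ P).coeff 0 : ℝ) + (p %ₘ P).coeff 1 * w + (p %ₘ P).coeff 2 * w ^ 2 := by
    intro w hw
    rw [← aeval_modByMonic_eq_self_of_root hw, aeval_eq_sum_range' hlt]
    simp [Finset.sum_range_succ]
  rw [hev x hx] at h1 ⊢
  rw [hev y hy] at h2
  rw [hev z hz] at h3
  obtain ⟨b0, b1, b2⟩ := hB _ _ _ h1 h2 h3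
  exact ⟨((p %ₘ P).coeff 0, (p %ₘ P).coeff 1, (p %ₘ P).coeff 2), ⟨b0, b1, b2⟩, rfl⟩

lemma exists_bound_of_finite {β : ℝ} {F : Set ℝ} (hF : F.Finite) :
    ∃ L : ℕ, ∀ z ∈ F, (∃ n, (betaT β)^[n] z = 0) → (betaT β)^[L] z = 0 := by
  induction F, hF using Set.Finite.induction_on with
  | empty => exact ⟨0, by simp⟩
  | @insert z F _ _ ih =>
    obtain ⟨L, hL⟩ := ih
    by_cases h : ∃ n, (betaT β)^[n] z = 0
    · obtain ⟨n, hn⟩ := h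
      refine ⟨max n L, ?_⟩
      rintro t (rfl | ht) hex
      · exact betaT_iterate_eq_zero_of_le (le_max_left _ _) hn
      · exact betaT_iterate_eq_zero_of_le (le_max_right _ _) (hL t ht hex)
    · refine ⟨L, ?_⟩
      rintro t (rfl | ht) hex
      · exact absurd hex h
      · exact hL t ht hex

/-- If `β` is a cubic Pisot number with distinct real conjugates, then the lengths of the
fractional parts of finite products of `β`-integers are bounded. -/
lemma exists_mul_bound {P : ℤ[X]} (hP : P.Monic) (hdeg : P.natDegree = 3) {β γ δ : ℝ}
    (hβ : 1 < β) (hγ : |γ| < 1) (hδ : |δ| < 1) (hγδ : γ ≠ δ) (h1 : aeval β P = 0)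
    (h2 : aeval γ P = 0) (h3 : aeval δ P = 0) :
    ∃ L : ℕ, ∀ x ∈ betaInt β, ∀ y ∈ betaInt β,
      x * y ∈ finBeta β → β ^ L * (x * y) ∈ betaInt β := by
  have hpos : 0 < β := by linarith
  have hβγ : β ≠ γ := by
    rintro rfl
    linarith [le_abs_self β]
  have hβδ : β ≠ δ := by
    rintro rfl
    linarith [le_abs_self β]
  set K : ℝ → ℝ := fun t => (β + 1) / (1 - |t|) with hK
  set C : ℝ := max 1 (max (K γ * K γ + K γ) (K δ * K δ + K δ)) with hC
  obtain ⟨L, hL⟩ := exists_bound_of_finite (β := β)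
    (finite_aeval_of_bounded hP hdeg hβγ hβδ hγδ h1 h2 h3 C)
  refine ⟨L, ?_⟩
  rintro x ⟨M, hM, hx⟩ y ⟨N, hN, hy⟩ ⟨R, n, hR, hn⟩
  obtain ⟨p, hp, hpb⟩ := exists_digit_polynomial hβ (lt_add_one β) hM M
  obtain ⟨q, hq, hqb⟩ := exists_digit_polynomial hβ (lt_add_one β) hN N
  obtain ⟨r, hr, hrb⟩ := exists_digit_polynomial hβ (lt_add_one β) hR R
  rw [hx, sub_zero, mul_div_cancel₀ _ (pow_pos hpos M).ne'] at hp
  rw [hy, sub_zero, mul_div_cancel₀ _ (pow_pos hpos N).ne'] at hq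
  rw [mul_div_cancel₀ _ (pow_pos hpos R).ne'] at hr
  rw [pow_mul_mem_betaInt_iff hβ hR, Function.iterate_add_apply]
  have hval : aeval β (p * q - r) = (betaT β)^[R] (|x * y| / β ^ R) := by
    rw [map_sub, map_mul, hp, hq, hr, abs_mul]
    ring
  have hbound : ∀ t : ℝ, |t| < 1 → |aeval t (p * q - r)| ≤ K t * K t + K t := by
    intro t ht
    rw [map_sub, map_mul]
    refine (abs_sub _ _).trans (add_le_add ?_ (hrb t ht))
    rw [abs_mul]
    exact mul_le_mul (hpb t ht) (hqb t ht) (abs_nonneg _) ((abs_nonneg _).trans (hpb t ht))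
  refine hL _ ⟨p * q - r, hval, ?_, ?_, ?_⟩ ⟨n, ?_⟩
  · rw [hval, abs_of_nonneg (betaT_iterate_mem hR R).1]
    exact (betaT_iterate_mem hR R).2.le.trans (le_max_left _ _)
  · exact (hbound γ hγ).trans ((le_max_left _ _).trans (le_max_right _ _))
  · exact (hbound δ hδ).trans ((le_max_right _ _).trans (le_max_right _ _))
  · rw [← Function.iterate_add_apply]
    exact betaT_iterate_eq_zero_of_le (by omega) hn

lemma exists_mul_bound_of_cubic {a b : ℤ} (hb0 : 0 ≤ b) (hba : b ≤ a - 3) {β : ℝ} (hβ : 1 < β)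
    (hroot : β ^ 3 - (a : ℝ) * β ^ 2 + (b : ℝ) * β + 1 = 0) :
    ∃ L : ℕ, ∀ x ∈ betaInt β, ∀ y ∈ betaInt β,
      x * y ∈ finBeta β → β ^ L * (x * y) ∈ betaInt β := by
  have hb0' : (0 : ℝ) ≤ b := by exact_mod_cast hb0
  have hba' : (b : ℝ) ≤ a - 3 := by exact_mod_cast hba
  set f : ℝ → ℝ := fun t => t ^ 3 - (a : ℝ) * t ^ 2 + (b : ℝ) * t + 1 with hf
  have hcont : Continuous f := by fun_prop
  obtain ⟨γ, hγ, hγ0⟩ : (0 : ℝ) ∈ f '' Set.Ioo 0 1 :=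
    intermediate_value_Ioo' zero_le_one hcont.continuousOn
      ⟨by simp only [hf]; linarith, by simp [hf]⟩
  obtain ⟨δ, hδ, hδ0⟩ : (0 : ℝ) ∈ f '' Set.Ioo (-1) 0 :=
    intermediate_value_Ioo (by norm_num) hcont.continuousOn
      ⟨by simp only [hf]; linarith, by simp [hf]⟩
  have hP : (X ^ 3 - C a * X ^ 2 + C b * X + 1 : ℤ[X]).Monic := by monicity!
  have hdeg : (X ^ 3 - C a * X ^ 2 + C b * X + 1 : ℤ[X]).natDegree = 3 := by compute_degree!
  have hev : ∀ t : ℝ, aeval t (X ^ 3 - C a * X ^ 2 + C b * X + 1 : ℤ[X]) = f t := fun t => by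
    simp [hf]
  exact exists_mul_bound hP hdeg hβ (abs_lt.2 ⟨by linarith [hγ.1], hγ.2⟩)
    (abs_lt.2 ⟨hδ.1, by linarith [hδ.2]⟩) (by linarith [hγ.1, hδ.2] : δ < γ).ne'
    ((hev β).trans hroot) ((hev γ).trans hγ0) ((hev δ).trans hδ0)

/-- If the greedy expansion of `w` has last digit `1` at position `-(L + 1)`, then `w ∈ fin(β)`
while `β ^ L * w` is not a `β`-integer. -/
lemma mem_finBeta_and_not_mem_betaInt {β : ℝ} (hβ : 1 < β) {w : ℝ} {N L : ℕ}
    (hN : |w| / β ^ N ∈ Set.Ico (0 : ℝ) 1) (h : (betaT β)^[L + N] (|w| / β ^ N) = β⁻¹) :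
    w ∈ finBeta β ∧ β ^ L * w ∉ betaInt β := by
  have hne : β ≠ 0 := by linarith
  refine ⟨⟨N, L + N + 1, hN, ?_⟩, ?_⟩
  · rw [Function.iterate_succ_apply', h]
    exact betaT_eq 1 (by simp [hne]) le_rfl one_pos
  · rw [pow_mul_mem_betaInt_iff hβ hN, h]
    exact inv_ne_zero hne

/-- The case `b = 0`, in terms of `s = 1 / β`. -/
lemma exists_mul_of_cubic_zero {a : ℤ} {s : ℝ} (hs0 : 0 < s) (hs : s < 1 / 2)
    (ha : (a : ℝ) = s⁻¹ + s ^ 2) :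
    ∃ x ∈ betaInt s⁻¹, ∃ y ∈ betaInt s⁻¹,
      x * y ∈ finBeta s⁻¹ ∧ (s⁻¹) ^ 3 * (x * y) ∉ betaInt s⁻¹ := by
  have hβ : 1 < s⁻¹ := by
    rw [one_lt_inv₀ hs0]
    linarith
  have hs2 : s ^ 2 < s / 2 := by nlinarith
  have hs3 : s ^ 3 < s ^ 2 / 2 := by nlinarith [pow_pos hs0 2]
  have hs4 : s ^ 4 < s ^ 3 / 2 := by nlinarith [pow_pos hs0 3]
  have hs5 : s ^ 5 < s ^ 4 / 2 := by nlinarith [pow_pos hs0 4]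
  have hs6 : s ^ 6 < s ^ 5 / 2 := by nlinarith [pow_pos hs0 5]
  have hs8 : s ^ 8 < s ^ 6 / 2 := by nlinarith [pow_pos hs0 6, pow_pos hs0 7]
  have hs9 : s ^ 9 < s ^ 8 / 2 := by nlinarith [pow_pos hs0 8]
  have hs10 : s ^ 10 < s ^ 9 / 2 := by nlinarith [pow_pos hs0 9]
  have p2 := pow_pos hs0 2
  have p5 := pow_pos hs0 5
  have p10 := pow_pos hs0 10
  have last : betaT s⁻¹ (1 - s + s ^ 3) = 0 :=
    betaT_eq (a - 1) (by push_cast; rw [ha]; field_simp; ring) le_rfl one_pos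
  refine ⟨(a - 1) * s⁻¹ ^ 2 + (a - 1), ⟨3, ?_⟩, (a - 1) * s⁻¹ ^ 2 + (a - 2) * s⁻¹ + (a - 1),
    ⟨3, ?_⟩, ?_⟩
  · have hx : |(a - 1) * s⁻¹ ^ 2 + (a - 1)| / s⁻¹ ^ 3 = 1 - s + s ^ 2 + s ^ 5 := by
      have : (0 : ℝ) ≤ a - 1 := by rw [ha]; linarith
      rw [abs_of_nonneg (by positivity), ha]
      field_simp
      ring
    have t1 : betaT s⁻¹ (1 - s + s ^ 2 + s ^ 5) = s - s ^ 2 + s ^ 4 :=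
      betaT_eq (a - 1) (by push_cast; rw [ha]; field_simp; ring) (by linarith) (by linarith)
    have t2 : betaT s⁻¹ (s - s ^ 2 + s ^ 4) = 1 - s + s ^ 3 :=
      betaT_eq 0 (by push_cast; field_simp; ring) (by linarith) (by linarith)
    rw [hx]
    exact ⟨⟨by linarith, by linarith⟩, by
      simp only [Function.iterate_succ_apply, Function.iterate_zero, id, t1, t2, last]⟩
  · have hy : |(a - 1) * s⁻¹ ^ 2 + (a - 2) * s⁻¹ + (a - 1)| / s⁻¹ ^ 3
        = 1 - s ^ 2 + s ^ 4 + s ^ 5 := by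
      have h1 : (0 : ℝ) ≤ a - 1 := by rw [ha]; linarith
      have h2 : (0 : ℝ) ≤ a - 2 := by
        have : 2 < s⁻¹ := by
          rw [lt_inv_comm₀ two_pos hs0]
          linarith
        rw [ha]
        linarith
      rw [abs_of_nonneg (by positivity), ha]
      field_simp
      ring
    have t1 : betaT s⁻¹ (1 - s ^ 2 + s ^ 4 + s ^ 5) = 1 - s - s ^ 2 + s ^ 3 + s ^ 4 :=
      betaT_eq (a - 1) (by push_cast; rw [ha]; field_simp; ring) (by linarith) (by linarith)
    have t2 : betaT s⁻¹ (1 - s - s ^ 2 + s ^ 3 + s ^ 4) = 1 - s + s ^ 3 :=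
      betaT_eq (a - 2) (by push_cast; rw [ha]; field_simp; ring) (by linarith) (by linarith)
    rw [hy]
    exact ⟨⟨by linarith, by linarith⟩, by
      simp only [Function.iterate_succ_apply, Function.iterate_zero, id, t1, t2, last]⟩
  · have hxy : |((a - 1) * s⁻¹ ^ 2 + (a - 1)) * ((a - 1) * s⁻¹ ^ 2 + (a - 2) * s⁻¹ + (a - 1))|
        / s⁻¹ ^ 6 = 1 - s + s ^ 3 + s ^ 5 + s ^ 9 + s ^ 10 := by
      have h : ((a - 1) * s⁻¹ ^ 2 + (a - 1)) * ((a - 1) * s⁻¹ ^ 2 + (a - 2) * s⁻¹ + (a - 1))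
          = (1 - s + s ^ 3 + s ^ 5 + s ^ 9 + s ^ 10) * s⁻¹ ^ 6 := by
        rw [ha]
        field_simp
        ring
      have hnonneg : 0 ≤ 1 - s + s ^ 3 + s ^ 5 + s ^ 9 + s ^ 10 := by linarith
      rw [h, abs_of_nonneg (by positivity)]
      field_simp
    have t1 : betaT s⁻¹ (1 - s + s ^ 3 + s ^ 5 + s ^ 9 + s ^ 10) = s ^ 4 + s ^ 8 + s ^ 9 :=
      betaT_eq (a - 1) (by push_cast; rw [ha]; field_simp; ring) (by linarith) (by linarith)
    have t5 : (betaT s⁻¹)^[3] (s ^ 4 + s ^ 8 + s ^ 9) = s + s ^ 5 + s ^ 6 := by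
      convert betaT_iterate_div_pow hβ (w := s + s ^ 5 + s ^ 6) ⟨by linarith, by linarith⟩ 3 using 2
      field_simp
    have t6 : betaT s⁻¹ (s + s ^ 5 + s ^ 6) = s ^ 4 + s ^ 5 :=
      betaT_eq 1 (by push_cast; field_simp; ring) (by linarith) (by linarith)
    have t9 : (betaT s⁻¹)^[3] (s ^ 4 + s ^ 5) = s + s ^ 2 := by
      convert betaT_iterate_div_pow hβ (w := s + s ^ 2) ⟨by linarith, by linarith⟩ 3 using 2
      field_simp
    have t10 : betaT s⁻¹ (s + s ^ 2) = s :=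
      betaT_eq 1 (by push_cast; field_simp) (by linarith) (by linarith)
    refine mem_finBeta_and_not_mem_betaInt hβ (N := 6) ?_ ?_ <;> rw [hxy]
    · exact ⟨by linarith, by linarith⟩
    · rw [Function.iterate_succ_apply, t1, Function.iterate_add_apply _ 5 3, t5,
        Function.iterate_succ_apply, t6, Function.iterate_succ_apply', t9, t10, inv_inv]

/-- The case `b = 1`, in terms of `s = 1 / β`. -/
lemma exists_mul_of_cubic_one {a : ℤ} {s : ℝ} (hs0 : 0 < s) (hs : s < 1 / 3)
    (ha : (a : ℝ) = s⁻¹ + s + s ^ 2) :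
    ∃ x ∈ betaInt s⁻¹, ∃ y ∈ betaInt s⁻¹,
      x * y ∈ finBeta s⁻¹ ∧ (s⁻¹) ^ 3 * (x * y) ∉ betaInt s⁻¹ := by
  have hβ : 3 < s⁻¹ := by
    rw [lt_inv_comm₀ three_pos hs0]
    linarith
  have hβ1 : 1 < s⁻¹ := by linarith
  have hs2 : s ^ 2 < s / 3 := by nlinarith
  have hs3 : s ^ 3 < s ^ 2 / 3 := by nlinarith [pow_pos hs0 2]
  have hs4 : s ^ 4 < s ^ 3 / 3 := by nlinarith [pow_pos hs0 3]
  have hs5 : s ^ 5 < s ^ 4 / 3 := by nlinarith [pow_pos hs0 4]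
  have hs6 : s ^ 6 < s ^ 5 / 3 := by nlinarith [pow_pos hs0 5]
  have hs7 : s ^ 7 < s ^ 6 / 3 := by nlinarith [pow_pos hs0 6]
  have p7 := pow_pos hs0 7
  have h1 : (0 : ℝ) ≤ a - 1 := by rw [ha]; linarith
  have h2 : (0 : ℝ) ≤ a - 2 := by rw [ha]; linarith
  have last : betaT s⁻¹ (1 - s + s ^ 2 + s ^ 3) = 0 :=
    betaT_eq (a - 1) (by push_cast; rw [ha]; field_simp; ring) le_rfl one_pos
  refine ⟨a - 1, ⟨1, ?_⟩, (a - 2) * s⁻¹ + (a - 1), ⟨2, ?_⟩, ?_⟩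
  · have hx : |(a : ℝ) - 1| / s⁻¹ ^ 1 = 1 - s + s ^ 2 + s ^ 3 := by
      rw [abs_of_nonneg h1, ha]
      field_simp
      ring
    rw [hx]
    exact ⟨⟨by linarith, by linarith⟩, last⟩
  · have hy : |(a - 2) * s⁻¹ + (a - 1)| / s⁻¹ ^ 2 = 1 - s + 2 * s ^ 3 + s ^ 4 := by
      rw [abs_of_nonneg (by positivity), ha]
      field_simp
      ring
    have t1 : betaT s⁻¹ (1 - s + 2 * s ^ 3 + s ^ 4) = 1 - s + s ^ 2 + s ^ 3 :=
      betaT_eq (a - 2) (by push_cast; rw [ha]; field_simp; ring) (by linarith) (by linarith)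
    rw [hy]
    exact ⟨⟨by linarith, by linarith⟩, by
      simp only [Function.iterate_succ_apply, Function.iterate_zero, id, t1, last]⟩
  · have hxy : |((a : ℝ) - 1) * ((a - 2) * s⁻¹ + (a - 1))| / s⁻¹ ^ 3
        = (a - 2) * s + s ^ 2 + (a - 2) * s ^ 4 + 2 * s ^ 6 + s ^ 7 := by
      rw [abs_of_nonneg (by positivity), ha]
      field_simp
      ring
    have e : (a - 2) * s = 1 - 2 * s + s ^ 2 + s ^ 3 := by
      rw [ha]
      field_simp
      ring
    have e2 : (a - 2) * s ^ 2 = s - 2 * s ^ 2 + s ^ 3 + s ^ 4 := by linear_combination s * e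
    have e3 : (a - 2) * s ^ 3 = s ^ 2 - 2 * s ^ 3 + s ^ 4 + s ^ 5 := by linear_combination s ^ 2 * e
    have e4 : (a - 2) * s ^ 4 = s ^ 3 - 2 * s ^ 4 + s ^ 5 + s ^ 6 := by linear_combination s ^ 3 * e
    have t1 : betaT s⁻¹ ((a - 2) * s + s ^ 2 + (a - 2) * s ^ 4 + 2 * s ^ 6 + s ^ 7)
        = s + (a - 2) * s ^ 3 + 2 * s ^ 5 + s ^ 6 :=
      betaT_eq (a - 2) (by push_cast; field_simp; ring) (by linarith) (by linarith)
    have t2 : betaT s⁻¹ (s + (a - 2) * s ^ 3 + 2 * s ^ 5 + s ^ 6)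
        = (a - 2) * s ^ 2 + 2 * s ^ 4 + s ^ 5 :=
      betaT_eq 1 (by push_cast; field_simp; ring) (by linarith) (by linarith)
    have t3 : betaT s⁻¹ ((a - 2) * s ^ 2 + 2 * s ^ 4 + s ^ 5)
        = (a - 2) * s + 2 * s ^ 3 + s ^ 4 :=
      betaT_eq 0 (by push_cast; field_simp; ring) (by linarith) (by linarith)
    have t4 : betaT s⁻¹ ((a - 2) * s + 2 * s ^ 3 + s ^ 4) = 2 * s ^ 2 + s ^ 3 :=
      betaT_eq (a - 2) (by push_cast; field_simp; ring) (by linarith) (by linarith)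
    have t5 : betaT s⁻¹ (2 * s ^ 2 + s ^ 3) = 2 * s + s ^ 2 :=
      betaT_eq 0 (by push_cast; field_simp; ring) (by linarith) (by linarith)
    have t6 : betaT s⁻¹ (2 * s + s ^ 2) = s :=
      betaT_eq 2 (by push_cast; field_simp) (by linarith) (by linarith)
    refine mem_finBeta_and_not_mem_betaInt hβ1 (N := 3) ?_ ?_ <;> rw [hxy]
    · exact ⟨by linarith, by linarith⟩
    · simp only [Nat.reduceAdd, Function.iterate_succ_apply, Function.iterate_zero, id, t1, t2, t3,
        t4, t5, t6, inv_inv]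

theorem stmt18 (a b : ℤ) (hbcase : b = 0 ∨ b = 1) (hb0 : 0 ≤ b)
    (hba : b ≤ a - 3) (β : ℝ) (hβ : 1 < β)
    (hroot : β ^ 3 - (a : ℝ) * β ^ 2 + (b : ℝ) * β + 1 = 0) :
    4 ≤ Lmul β ∧
    ∃ x ∈ betaInt β, ∃ y ∈ betaInt β,
      x * y ∈ finBeta β ∧ β ^ 3 * (x * y) ∉ betaInt β := by
  have hpos : 0 < β := by linarith
  have key : ∃ x ∈ betaInt β, ∃ y ∈ betaInt β,
      x * y ∈ finBeta β ∧ β ^ 3 * (x * y) ∉ betaInt β := by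
    have hba' : (b : ℝ) ≤ a - 3 := by exact_mod_cast hba
    have ha : (a : ℝ) = β + b * β⁻¹ + β⁻¹ ^ 2 := by
      field_simp
      linarith
    have hsq : β < β ^ 2 := by nlinarith
    have hlt : (a : ℝ) - 1 < β := by
      by_contra! hle
      rcases hbcase with rfl | rfl
      · push_cast at *
        nlinarith
      · push_cast at *
        nlinarith
    rcases hbcase with rfl | rfl
    · push_cast at *
      have := exists_mul_of_cubic_zero (a := a) (inv_pos.2 hpos)
        (by rw [inv_lt_comm₀ hpos (by norm_num)]; norm_num; linarith)
        (by rw [ha, inv_inv]; ring)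
      rwa [inv_inv] at this
    · push_cast at *
      have := exists_mul_of_cubic_one (a := a) (inv_pos.2 hpos)
        (by rw [inv_lt_comm₀ hpos (by norm_num)]; norm_num; linarith)
        (by rw [ha, inv_inv]; ring)
      rwa [inv_inv] at this
  refine ⟨le_csInf (exists_mul_bound_of_cubic hb0 hba hβ hroot) fun L hL => ?_, key⟩
  by_contra! hlt
  obtain ⟨x, hx, y, hy, hxy, hnot⟩ := key
  exact hnot (pow_mul_mem_betaInt_mono hβ (by omega) (hL x hx y hy hxy))
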